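/- With the fixed-pair setup in a diregular (2,k,+3)-digraph with k ≥ 3: v₁ ∈ N^{k-1}(u₁) ∪ O(u) and u₁ ∈ N^{k-1}(v₁) ∪ O(v). -/

import Mathlib

/-- `p` is a directed walk from `u` to `v` in the digraph with arc relation `A`,
recorded as the list of its vertices; a walk of length `l` (i.e. with `l` arcs)
is a list of `l + 1` vertices. -/
def IsWalkFrom {V : Type*} (A : V → V → Prop) (u v : V) (p : List V) : Prop :=
  p.Chain' A ∧ p.head? = some u ∧ p.getLast? = some v

/-- A digraph is `k`-geodetic if for every ordered pair of vertices `(u, v)`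
there is at most one directed path of length at most `k` from `u` to `v`. -/
def IsKGeodetic {V : Type*} (A : V → V → Prop) (k : ℕ) : Prop :=
  ∀ (u v : V) (p q : List V), IsWalkFrom A u v p → IsWalkFrom A u v q →
    p.length ≤ k + 1 → q.length ≤ k + 1 → p = q

/-- `Nout A u = N⁺(u)`, the set of out-neighbours of `u`. -/
def Nout {V : Type*} (A : V → V → Prop) (u : V) : Set V := {v | A u v}

/-- `Nin A u = N⁻(u)`, the set of in-neighbours of `u`. -/
def Nin {V : Type*} (A : V → V → Prop) (u : V) : Set V := {v | A v u}

/-- `NIter A l u = N^l(u)`, the set of vertices reachable from `u` by a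
directed path of length exactly `l`. -/
def NIter {V : Type*} (A : V → V → Prop) (l : ℕ) (u : V) : Set V :=
  {v | ∃ p : List V, IsWalkFrom A u v p ∧ p.length = l + 1}

/-- `Ball A l u = T_l(u) = N^0(u) ∪ N^1(u) ∪ ⋯ ∪ N^l(u)`, the set of vertices
at distance at most `l` from `u`. -/
def Ball {V : Type*} (A : V → V → Prop) (l : ℕ) (u : V) : Set V :=
  {v | ∃ m ≤ l, v ∈ NIter A m u}

/-- `Outliers A k u = O(u) = {v | d(u,v) ≥ k + 1}`, the outlier set of `u`. -/
def Outliers {V : Type*} (A : V → V → Prop) (k : ℕ) (u : V) : Set V :=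
  {v | v ∉ Ball A k u}

/-- A digraph is diregular with degree `d` if every vertex has out-degree `d`
and in-degree `d`. -/
def IsDiregular {V : Type*} (A : V → V → Prop) (d : ℕ) : Prop :=
  ∀ u : V, (Nout A u).ncard = d ∧ (Nin A u).ncard = d

/-- The Moore bound `M(d,k) = 1 + d + d² + ⋯ + d^k`. -/
def moore (d k : ℕ) : ℕ := ∑ i ∈ Finset.range (k + 1), d ^ i

section NIter

variable {V : Type*} {A : V → V → Prop} {a b b' c : V} {k m n : ℕ}

theorem mem_NIter_zero : b ∈ NIter A 0 a ↔ b = a := by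
  constructor
  · rintro ⟨p, ⟨-, hh, hl⟩, hp⟩
    obtain ⟨x, rfl⟩ := List.length_eq_one_iff.mp hp
    simp_all
  · rintro rfl
    exact ⟨[b], ⟨List.isChain_singleton _, rfl, rfl⟩, rfl⟩

theorem IsWalkFrom.concat {p : List V} (hp : IsWalkFrom A a b p) (h : A b c) :
    IsWalkFrom A a c (p ++ [c]) := by
  obtain ⟨hc, hh, hl⟩ := hp
  refine ⟨List.IsChain.append hc (List.isChain_singleton _) ?_, ?_, by simp⟩
  · intro x hx y hy
    simp_all
  · simp [hh]

theorem IsWalkFrom.cons {p : List V} (h : A a b) (hp : IsWalkFrom A b c p) :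
    IsWalkFrom A a c (a :: p) := by
  obtain ⟨hc, hh, hl⟩ := hp
  cases p with
  | nil => simp at hh
  | cons x p =>
    obtain rfl : x = b := by simpa using hh
    exact ⟨List.IsChain.cons_cons h hc, rfl, by simpa [List.getLast?_cons_cons] using hl⟩

theorem mem_NIter_cons (h : A a b) (hc : c ∈ NIter A n b) : c ∈ NIter A (n + 1) a := by
  obtain ⟨p, hp, hl⟩ := hc
  exact ⟨a :: p, hp.cons h, by simp [hl]⟩

theorem exists_of_mem_NIter_succ (hc : c ∈ NIter A (n + 1) a) :
    ∃ b, A a b ∧ c ∈ NIter A n b := by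
  obtain ⟨p, ⟨hch, hh, hl⟩, hlen⟩ := hc
  match p, hlen with
  | x :: y :: p, hlen =>
    obtain rfl : x = a := by simpa using hh
    obtain ⟨hxy, hp⟩ := List.isChain_cons_cons.mp hch
    exact ⟨y, hxy, y :: p, ⟨hp, rfl, by simpa [List.getLast?_cons_cons] using hl⟩,
      by simpa using hlen⟩

theorem mem_NIter_one (h : A a b) : b ∈ NIter A 1 a :=
  mem_NIter_cons h (mem_NIter_zero.mpr rfl)

theorem mem_NIter_add (hb : b ∈ NIter A m a) (hc : c ∈ NIter A n b) :
    c ∈ NIter A (m + n) a := by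
  induction m generalizing a with
  | zero =>
    obtain rfl := mem_NIter_zero.mp hb
    simpa using hc
  | succ m ih =>
    obtain ⟨x, hx, hb⟩ := exists_of_mem_NIter_succ hb
    have := mem_NIter_cons hx (ih hb)
    rwa [Nat.add_right_comm] at this

theorem mem_NIter_succ : c ∈ NIter A (n + 1) a ↔ ∃ b ∈ NIter A n a, A b c := by
  constructor
  · intro h
    induction n generalizing a with
    | zero =>
      obtain ⟨b, hb, hc⟩ := exists_of_mem_NIter_succ h
      obtain rfl := mem_NIter_zero.mp hc
      exact ⟨a, mem_NIter_zero.mpr rfl, hb⟩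
    | succ n ih =>
      obtain ⟨x, hx, hc⟩ := exists_of_mem_NIter_succ h
      obtain ⟨b, hb, hbc⟩ := ih hc
      exact ⟨b, mem_NIter_cons hx hb, hbc⟩
  · rintro ⟨b, hb, hbc⟩
    exact mem_NIter_add hb (mem_NIter_one hbc)

theorem IsKGeodetic.length_unique (hg : IsKGeodetic A k) (hm : b ∈ NIter A m a)
    (hn : b ∈ NIter A n a) (hmk : m ≤ k) (hnk : n ≤ k) : m = n := by
  obtain ⟨p, hp, hpl⟩ := hm
  obtain ⟨q, hq, hql⟩ := hn
  have := congrArg List.length (hg a b p q hp hq (by omega) (by omega))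
  omega

theorem IsKGeodetic.first_unique (hg : IsKGeodetic A k) (hb : A a b) (hb' : A a b')
    (hm : c ∈ NIter A m b) (hn : c ∈ NIter A n b') (hmk : m + 1 ≤ k) (hnk : n + 1 ≤ k) :
    b = b' := by
  obtain ⟨p, hp, hpl⟩ := hm
  obtain ⟨q, hq, hql⟩ := hn
  have h := hg a c _ _ (hp.cons hb) (hq.cons hb') (by simp; omega) (by simp; omega)
  obtain rfl : p = q := by simpa using h
  simpa [hp.2.1] using hq.2.1

theorem IsKGeodetic.last_unique (hg : IsKGeodetic A k) (hb : b ∈ NIter A n a)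
    (hb' : b' ∈ NIter A n a) (hc : A b c) (hc' : A b' c) (hnk : n + 1 ≤ k) : b = b' := by
  obtain ⟨p, hp, hpl⟩ := hb
  obtain ⟨q, hq, hql⟩ := hb'
  have h := hg a c _ _ (hp.concat hc) (hq.concat hc') (by simp; omega) (by simp; omega)
  obtain rfl : p = q := by simpa using h
  simpa [hp.2.2] using hq.2.2

end NIter

section Counting

variable {V : Type*} [Fintype V] {A : V → V → Prop} {d k : ℕ}

open Classical in
theorem IsKGeodetic.ncard_NIter (hg : IsKGeodetic A k) (hd : ∀ x, (Nout A x).ncard = d)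
    (a : V) {n : ℕ} (hn : n ≤ k) : (NIter A n a).ncard = d ^ n := by
  induction n with
  | zero =>
    have : NIter A 0 a = {a} := Set.ext fun _ => mem_NIter_zero
    simp [this]
  | succ n ih =>
    have h : (NIter A (n + 1) a).toFinset
        = (NIter A n a).toFinset.biUnion fun x => (Nout A x).toFinset := by
      ext c
      simp only [Set.mem_toFinset, Finset.mem_biUnion]
      exact mem_NIter_succ
    rw [Set.ncard_eq_toFinset_card', h, Finset.card_biUnion]
    · simp_rw [← Set.ncard_eq_toFinset_card', hd]
      rw [Finset.sum_const, ← Set.ncard_eq_toFinset_card', ih (by omega), smul_eq_mul, pow_succ]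
    · intro x hx y hy hxy
      rw [Function.onFun, Finset.disjoint_left]
      intro c hc hc'
      simp only [Set.mem_toFinset, Set.coe_toFinset] at hx hy hc hc'
      exact hxy (hg.last_unique hx hy hc hc' hn)

open Classical in
theorem IsKGeodetic.ncard_Ball (hg : IsKGeodetic A k) (hd : ∀ x, (Nout A x).ncard = d) (a : V) :
    (Ball A k a).ncard = moore d k := by
  have h : (Ball A k a).toFinset
      = (Finset.range (k + 1)).biUnion fun n => (NIter A n a).toFinset := by
    ext c
    simp only [Set.mem_toFinset, Finset.mem_biUnion, Finset.mem_range, Nat.lt_succ_iff]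
    rfl
  rw [Set.ncard_eq_toFinset_card', h, Finset.card_biUnion]
  · refine Finset.sum_congr rfl fun n hn => ?_
    rw [← Set.ncard_eq_toFinset_card', hg.ncard_NIter hd a (by simpa [Nat.lt_succ_iff] using hn)]
  · intro m hm n hn hmn
    rw [Function.onFun, Finset.disjoint_left]
    intro c hc hc'
    simp only [Set.mem_toFinset, Finset.coe_range, Set.mem_Iio, Nat.lt_succ_iff] at hm hn hc hc'
    exact hmn (hg.length_unique hc hc' hm hn)

theorem IsKGeodetic.ncard_Outliers {ε : ℕ} (hg : IsKGeodetic A k)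
    (hd : ∀ x, (Nout A x).ncard = d) (hcard : Fintype.card V = moore d k + ε) (a : V) :
    (Outliers A k a).ncard = ε := by
  have h : Outliers A k a = (Ball A k a)ᶜ := rfl
  have := Set.ncard_add_ncard_compl (Ball A k a)
  rw [← h, hg.ncard_Ball hd, Nat.card_eq_fintype_card] at this
  omega

end Counting

theorem mem_NIter_union_Outliers_of_common_out_neighbour {V : Type*} [Fintype V]
    {A : V → V → Prop} {k : ℕ} {u v u₁ u₂ v₁ : V}
    (hd : ∀ x, (Nout A x).ncard = 2) (hgeo : IsKGeodetic A k)
    (hcard : Fintype.card V = moore 2 k + 3)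
    (hu : Nout A u = {u₁, u₂}) (hv : Nout A v = {v₁, u₂}) (huv : u₁ ≠ v₁) (hk : 2 ≤ k) :
    v₁ ∈ NIter A (k - 1) u₁ ∪ Outliers A k u := by
  have au : ∀ x, A u x ↔ x = u₁ ∨ x = u₂ := fun x => by
    simpa [Nout] using Set.ext_iff.mp hu x
  have av : ∀ x, A v x ↔ x = v₁ ∨ x = u₂ := fun x => by
    simpa [Nout] using Set.ext_iff.mp hv x
  have hvv₁ : A v v₁ := (av _).mpr (.inl rfl)
  have hvu₂ : A v u₂ := (av _).mpr (.inr rfl)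
  have huu₁ : A u u₁ := (au _).mpr (.inl rfl)
  have huu₂ : A u u₂ := (au _).mpr (.inr rfl)
  have hv₁u₂ : v₁ ≠ u₂ := by
    rintro rfl
    have := hd v
    simp [hv] at this
  have ball_cases : ∀ x, x ∈ Ball A k u → x = u ∨ (∃ m, m + 1 ≤ k ∧ x ∈ NIter A m u₁) ∨
      ∃ m, m + 1 ≤ k ∧ x ∈ NIter A m u₂ := by
    rintro x ⟨m, hm, hx⟩
    cases m with
    | zero => exact .inl (mem_NIter_zero.mp hx)
    | succ m =>
      obtain ⟨y, hy, hx⟩ := exists_of_mem_NIter_succ hx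
      rcases (au y).mp hy with rfl | rfl
      · exact .inr (.inl ⟨m, hm, hx⟩)
      · exact .inr (.inr ⟨m, hm, hx⟩)
  by_contra hcon
  rw [Set.mem_union, not_or] at hcon
  obtain ⟨hlast, hball⟩ := hcon
  obtain ⟨l, hlk, hl⟩ : ∃ l, l + 1 ≤ k ∧ v₁ ∈ NIter A l u₁ := by
    rcases ball_cases v₁ (not_not.mp hball) with h | h | ⟨m, hm, h⟩
    · have h2 := mem_NIter_cons hvv₁ (mem_NIter_one (h ▸ huu₂ : A v₁ u₂))
      have := hgeo.length_unique h2 (mem_NIter_one hvu₂) hk (by omega)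
      omega
    · exact h
    · exact absurd (hgeo.first_unique hvv₁ hvu₂ (mem_NIter_zero.mpr rfl) h (by omega) hm) hv₁u₂
  have hl0 : l ≠ 0 := by
    rintro rfl
    exact huv (mem_NIter_zero.mp hl).symm
  have hl1 : l ≠ k - 1 := by
    rintro rfl
    exact hlast hl
  have hvO : v ∈ Outliers A k u := by
    intro hmem
    rcases ball_cases v hmem with h | ⟨m, hm, h⟩ | ⟨m, hm, h⟩
    · rcases (au v₁).mp (h ▸ hvv₁) with h | h
      exacts [huv h.symm, hv₁u₂ h]
    · have h1 := hgeo.length_unique (mem_NIter_succ.mpr ⟨v, h, hvv₁⟩) hl hm (by omega)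
      have h2 := mem_NIter_cons huu₁ (mem_NIter_succ.mpr ⟨v, h, hvu₂⟩)
      have := hgeo.length_unique h2 (mem_NIter_one huu₂) (by omega) (by omega)
      omega
    · have := hgeo.length_unique (mem_NIter_cons hvu₂ h) (mem_NIter_zero.mpr rfl) hm (by omega)
      omega
  have hsub : NIter A (k - l) v₁ ⊆ insert u (Outliers A k u) \ {v} := by
    intro w hw
    refine ⟨?_, ?_⟩
    · by_contra hw'
      rw [Set.mem_insert_iff, not_or] at hw'
      rcases ball_cases w (not_not.mp hw'.2) with h | ⟨m, hm, h⟩ | ⟨m, hm, h⟩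
      · exact hw'.1 h
      · have := hgeo.length_unique (mem_NIter_add hl hw) h (by omega) (by omega)
        omega
      · exact hv₁u₂ (hgeo.first_unique hvv₁ hvu₂ hw h (by omega) hm)
    · rintro rfl
      have := hgeo.length_unique (mem_NIter_cons hvv₁ hw) (mem_NIter_zero.mpr rfl)
        (by omega) (by omega)
      omega
  have h1 := Set.ncard_le_ncard hsub (Set.toFinite _)
  rw [hgeo.ncard_NIter hd v₁ (by omega),
    Set.ncard_sdiff_singleton_of_mem (Set.mem_insert_of_mem _ hvO)] at h1
  have h2 := Set.ncard_insert_le u (Outliers A k u)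
  rw [hgeo.ncard_Outliers hd hcard] at h2
  have h3 : 2 ^ 2 ≤ 2 ^ (k - l) := Nat.pow_le_pow_right (by norm_num) (by omega)
  omega

/-- Fixed-pair setup, `k ≥ 3`: `v₁ ∈ N^{k-1}(u₁) ∪ O(u)` and
`u₁ ∈ N^{k-1}(v₁) ∪ O(v)`. -/
theorem position_of_v1 {V : Type*} [Fintype V] (A : V → V → Prop) (k : ℕ)
    (u v u₁ u₂ v₁ : V)
    (hirr : Irreflexive A) (hreg : IsDiregular A 2) (hgeo : IsKGeodetic A k)
    (hcard : Fintype.card V = moore 2 k + 3)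
    (hu : Nout A u = {u₁, u₂}) (hv : Nout A v = {v₁, u₂}) (huv : u₁ ≠ v₁)
    (hk : 3 ≤ k) :
    v₁ ∈ NIter A (k - 1) u₁ ∪ Outliers A k u ∧
      u₁ ∈ NIter A (k - 1) v₁ ∪ Outliers A k v := by
  have hd := fun x => (hreg x).1
  exact ⟨mem_NIter_union_Outliers_of_common_out_neighbour hd hgeo hcard hu hv huv (by omega),
    mem_NIter_union_Outliers_of_common_out_neighbour hd hgeo hcard hv hu huv.symm (by omega)⟩
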